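/- Let X = {7, 8, 10, 13, 17, 21, 25, 27} ⊂ ℝ with the metric d(x,y) = |x − y|, let N_p = 2, and let C be the 2-clustering {{7, 8, 10, 13, 21}, {17, 25, 27}}. Then C is LM-separable for N_p = 2, but C is not weakly separable for N_p = 2. (Hence LM-separability does not imply weak separability.) -/

import Mathlib

variable {α : Type*}

/-- Sparsity ε_{N_p}(x): smallest ε ≥ 0 such that at least N_p points of X lie within
distance ε of x. -/
noncomputable def sparsity [MetricSpace α] (X : Finset α) (Np : ℕ) (x : α) : ℝ :=
  sInf {ε : ℝ | 0 ≤ ε ∧ Np ≤ (X.filter (fun y => dist x y ≤ ε)).card}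

/-- x is ε-connected to y: there is a finite sequence of points of X from x to y,
each of sparsity at most ε, with consecutive distances at most ε. -/
def EpsConn [MetricSpace α] (X : Finset α) (Np : ℕ) (ε : ℝ) (x y : α) : Prop :=
  x ∈ X ∧ sparsity X Np x ≤ ε ∧
    Relation.ReflTransGen (fun a b => b ∈ X ∧ sparsity X Np b ≤ ε ∧ dist a b ≤ ε) x y

/-- A set c is ε-connected if every pair of points of c is ε-connected. -/
def SetConn [MetricSpace α] (X : Finset α) (Np : ℕ) (ε : ℝ) (c : Finset α) : Prop :=
  ∀ x ∈ c, ∀ y ∈ c, EpsConn X Np ε x y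

/-- ε*(c): the minimum ε such that c is ε-connected. -/
noncomputable def setSparsity [MetricSpace α] (X : Finset α) (Np : ℕ) (c : Finset α) : ℝ :=
  sInf {ε : ℝ | SetConn X Np ε c}

/-- ε(x,y): the minimum ε such that x is ε-connected to y. -/
noncomputable def epsDist [MetricSpace α] (X : Finset α) (Np : ℕ) (x y : α) : ℝ :=
  sInf {ε : ℝ | EpsConn X Np ε x y}

/-- ε(x,c): min over y ∈ c of ε(x,y). -/
noncomputable def ptClusterDist [MetricSpace α] (X : Finset α) (Np : ℕ) (x : α)
    (c : Finset α) : ℝ :=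
  sInf {e : ℝ | ∃ y ∈ c, e = epsDist X Np x y}

/-- ε(c,c'): min over x ∈ c, y ∈ c' of ε(x,y). -/
noncomputable def clusterDist [MetricSpace α] (X : Finset α) (Np : ℕ)
    (c c' : Finset α) : ℝ :=
  sInf {e : ℝ | ∃ x ∈ c, ∃ y ∈ c', e = epsDist X Np x y}

/-- A clustering of X: a partition of X into nonempty clusters. -/
def IsClustering (X : Finset α) (C : Finset (Finset α)) : Prop :=
  (∀ c ∈ C, c.Nonempty) ∧ (∀ c ∈ C, ∀ c' ∈ C, c ≠ c' → Disjoint c c') ∧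
    (∀ c ∈ C, c ⊆ X) ∧ (∀ x ∈ X, ∃ c ∈ C, x ∈ c)

/-- C is weakly separable: for each cluster c, ε*(c) < min over c' ≠ c of ε(c,c'). -/
def WeaklySeparable [MetricSpace α] (X : Finset α) (Np : ℕ) (C : Finset (Finset α)) : Prop :=
  ∀ c ∈ C, ∀ c' ∈ C, c' ≠ c → setSparsity X Np c < clusterDist X Np c c'

/-- c is an ε-cluster: a (nonempty) maximal ε-connected subset of X. -/
def IsEpsCluster [MetricSpace α] (X : Finset α) (Np : ℕ) (ε : ℝ) (c : Finset α) : Prop :=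
  c.Nonempty ∧ SetConn X Np ε c ∧ ∀ x ∈ X, (∃ y ∈ c, EpsConn X Np ε x y) → x ∈ c

/-- c is a maximal cluster: an ε-cluster for some ε ≥ 0. -/
def IsMaximalCluster [MetricSpace α] (X : Finset α) (Np : ℕ) (c : Finset α) : Prop :=
  ∃ ε : ℝ, 0 ≤ ε ∧ IsEpsCluster X Np ε c

/-- x is a local maximum: every y ∈ X with d(x,y) ≤ ε_{N_p}(x) has sparsity ≥ that of x. -/
def IsLocalMaxPt [MetricSpace α] (X : Finset α) (Np : ℕ) (x : α) : Prop :=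
  x ∈ X ∧ ∀ y ∈ X, dist x y ≤ sparsity X Np x → sparsity X Np x ≤ sparsity X Np y

/-- X_c*: the points of c of minimum sparsity within c. -/
noncomputable def minSparsityPts [MetricSpace α] (X : Finset α) (Np : ℕ)
    (c : Finset α) : Finset α :=
  c.filter (fun x => ∀ y ∈ c, sparsity X Np x ≤ sparsity X Np y)

/-- Relative separability A(x,y) = ε(x,y) / ε_{N_p}(x). -/
noncomputable def relSep [MetricSpace α] (X : Finset α) (Np : ℕ) (x y : α) : ℝ :=
  epsDist X Np x y / sparsity X Np x

/-- A(x,c) = min over y ∈ c of A(x,y). -/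
noncomputable def relSepCluster [MetricSpace α] (X : Finset α) (Np : ℕ) (x : α)
    (c : Finset α) : ℝ :=
  sInf {a : ℝ | ∃ y ∈ c, a = relSep X Np x y}

/-- A^ℓ(C): the minimum A such that for every local maximum x, every y in the cluster of x
with sparsity at most that of x satisfies A(x,y) ≤ A. -/
noncomputable def Aell [MetricSpace α] (X : Finset α) (Np : ℕ)
    (C : Finset (Finset α)) : ℝ :=
  sInf {A : ℝ | ∀ x ∈ X, IsLocalMaxPt X Np x → ∀ c ∈ C, x ∈ c →
    ∀ y ∈ c, sparsity X Np y ≤ sparsity X Np x → relSep X Np x y ≤ A}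

/-- C is LM-separable: A^ℓ(C) < min over distinct clusters c, c' and z ∈ X_c* of A(z,c'). -/
def LMSeparable [MetricSpace α] (X : Finset α) (Np : ℕ) (C : Finset (Finset α)) : Prop :=
  ∀ c ∈ C, ∀ c' ∈ C, c ≠ c' → ∀ z ∈ minSparsityPts X Np c,
    Aell X Np C < relSepCluster X Np z c'

/-- min over x ∈ c of ε_{N_p}(x). -/
noncomputable def minSpars [MetricSpace α] (X : Finset α) (Np : ℕ) (c : Finset α) : ℝ :=
  sInf (sparsity X Np '' (c : Set α))

/-- max over x ∈ c of ε_{N_p}(x). -/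
noncomputable def maxSpars [MetricSpace α] (X : Finset α) (Np : ℕ) (c : Finset α) : ℝ :=
  sSup (sparsity X Np '' (c : Set α))

/-- C is strongly separable: there is an A such that each cluster c is
(A · min sparsity of c)-connected and A · min sparsity of c < min over c' ≠ c of ε(c,c'). -/
def StronglySeparable [MetricSpace α] (X : Finset α) (Np : ℕ)
    (C : Finset (Finset α)) : Prop :=
  ∃ A : ℝ, ∀ c ∈ C, SetConn X Np (A * minSpars X Np c) c ∧
    ∀ c' ∈ C, c' ≠ c → A * minSpars X Np c < clusterDist X Np c c'

/-- c*(x,ε): the set of points of X that are ε-connected to x. -/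
def epsClusterAt [MetricSpace α] (X : Finset α) (Np : ℕ) (ε : ℝ) (x : α) : Set α :=
  {y | EpsConn X Np ε x y}

theorem sparsity_nonneg [MetricSpace α] (X : Finset α) (Np : ℕ) (x : α) :
    0 ≤ sparsity X Np x :=
  Real.sInf_nonneg fun _ h => h.1

/-- For `N_p = 2` the sparsity of a point is the distance to a nearest other point. -/
theorem sparsity_two_eq_dist [MetricSpace α] {X : Finset α} {x y : α} (hx : x ∈ X) (hy : y ∈ X)
    (hne : x ≠ y) (hmin : ∀ z ∈ X, z ≠ x → dist x y ≤ dist x z) :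
    sparsity X 2 x = dist x y := by
  refine IsLeast.csInf_eq ⟨⟨dist_nonneg, ?_⟩, ?_⟩
  · exact Finset.one_lt_card.2 ⟨x, by simp [hx], y, by simp [hy], hne⟩
  · rintro ε ⟨-, hε⟩
    obtain ⟨z, hz, hzx⟩ := Finset.exists_mem_ne (Nat.lt_of_succ_le hε) x
    rw [Finset.mem_filter] at hz
    exact (hmin z hz.1 hzx).trans hz.2

theorem EpsConn.of_dist_le [MetricSpace α] {X : Finset α} {Np : ℕ} {ε : ℝ} {x y : α}
    (hx : x ∈ X) (hy : y ∈ X) (hsx : sparsity X Np x ≤ ε) (hsy : sparsity X Np y ≤ ε)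
    (hd : dist x y ≤ ε) : EpsConn X Np ε x y :=
  ⟨hx, hsx, .single ⟨hy, hsy, hd⟩⟩

theorem EpsConn.sparsity_right_le [MetricSpace α] {X : Finset α} {Np : ℕ} {ε : ℝ} {x y : α}
    (h : EpsConn X Np ε x y) : sparsity X Np y ≤ ε := by
  obtain ⟨-, hx, h⟩ := h
  cases h with
  | refl => exact hx
  | tail _ h => exact h.2.1

/-- A set of points closed under steps of length at most `ε` contains everything `ε`-connected
to one of its points. -/
theorem EpsConn.mem_of_closed [MetricSpace α] {X : Finset α} {Np : ℕ} {ε : ℝ} {x y : α}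
    (h : EpsConn X Np ε x y) {s : Set α} (hs : ∀ a ∈ s, ∀ b ∈ X, dist a b ≤ ε → b ∈ s)
    (hx : x ∈ s) : y ∈ s := by
  obtain ⟨-, -, h⟩ := h
  induction h with
  | refl => exact hx
  | tail _ h ih => exact hs _ ih _ h.1 h.2.2

theorem epsDist_le_of_epsConn [MetricSpace α] {X : Finset α} {Np : ℕ} {ε : ℝ} {x y : α}
    (h : EpsConn X Np ε x y) : epsDist X Np x y ≤ ε :=
  csInf_le ⟨sparsity X Np x, fun _ h => h.2.1⟩ h

theorem le_epsDist [MetricSpace α] {X : Finset α} {Np : ℕ} {r : ℝ} {x y : α}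
    (hx : x ∈ X) (hy : y ∈ X) (h : ∀ ε, EpsConn X Np ε x y → r ≤ ε) : r ≤ epsDist X Np x y :=
  le_csInf ⟨max (max (sparsity X Np x) (sparsity X Np y)) (dist x y),
    .of_dist_le hx hy (by simp) (by simp) (by simp)⟩ h

theorem epsDist_nonneg [MetricSpace α] (X : Finset α) (Np : ℕ) (x y : α) :
    0 ≤ epsDist X Np x y :=
  Real.sInf_nonneg fun _ h => (sparsity_nonneg X Np x).trans h.2.1

theorem clusterDist_le [MetricSpace α] (X : Finset α) (Np : ℕ) {c c' : Finset α} {x y : α}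
    (hx : x ∈ c) (hy : y ∈ c') : clusterDist X Np c c' ≤ epsDist X Np x y := by
  refine csInf_le ⟨0, ?_⟩ ⟨x, hx, y, hy, rfl⟩
  rintro _ ⟨x, -, y, -, rfl⟩
  exact epsDist_nonneg X Np x y

theorem relSepCluster_ge [MetricSpace α] {X : Finset α} {Np : ℕ} {c : Finset α} {x : α} {r : ℝ}
    (hc : c.Nonempty) (h : ∀ y ∈ c, r ≤ relSep X Np x y) : r ≤ relSepCluster X Np x c := by
  obtain ⟨y, hy⟩ := hc
  refine le_csInf ⟨_, y, hy, rfl⟩ ?_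
  rintro _ ⟨y, hy, rfl⟩
  exact h y hy

/-- The points `{7, 8, 10, 13, 17, 21, 25, 27}` of the real line. -/
local notation "lineX" => ({7, 8, 10, 13, 17, 21, 25, 27} : Finset ℝ)

theorem sparsity_lineX :
    sparsity lineX 2 7 = 1 ∧ sparsity lineX 2 8 = 1 ∧ sparsity lineX 2 10 = 2 ∧
      sparsity lineX 2 13 = 3 ∧ sparsity lineX 2 17 = 4 ∧ sparsity lineX 2 21 = 4 ∧
      sparsity lineX 2 25 = 2 ∧ sparsity lineX 2 27 = 2 := by
  have key : ∀ x y r : ℝ, x ∈ lineX → y ∈ lineX → x ≠ y → dist x y = r →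
      (∀ z ∈ lineX, z ≠ x → r ≤ dist x z) → sparsity lineX 2 x = r := by
    rintro x y _ hx hy hne rfl h
    exact sparsity_two_eq_dist hx hy hne h
  refine ⟨key 7 8 _ ?_ ?_ ?_ ?_ ?_, key 8 7 _ ?_ ?_ ?_ ?_ ?_, key 10 8 _ ?_ ?_ ?_ ?_ ?_,
    key 13 10 _ ?_ ?_ ?_ ?_ ?_, key 17 13 _ ?_ ?_ ?_ ?_ ?_, key 21 17 _ ?_ ?_ ?_ ?_ ?_,
    key 25 27 _ ?_ ?_ ?_ ?_ ?_, key 27 25 _ ?_ ?_ ?_ ?_ ?_⟩ <;>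
  norm_num [Real.dist_eq, abs_of_pos, abs_of_neg]

theorem isLocalMaxPt_lineX {x : ℝ} (h : IsLocalMaxPt lineX 2 x) :
    x = 7 ∨ x = 8 ∨ x = 25 ∨ x = 27 := by
  obtain ⟨s7, s8, s10, s13, s17, s21, s25, s27⟩ := sparsity_lineX
  obtain ⟨hx, h⟩ := h
  simp only [Finset.mem_insert, Finset.mem_singleton] at hx
  rcases hx with rfl | rfl | rfl | rfl | rfl | rfl | rfl | rfl
  · simp
  · simp
  · have := h 8 (by simp) (by rw [s10]; norm_num [Real.dist_eq]); linarith
  · have := h 10 (by simp) (by rw [s13]; norm_num [Real.dist_eq]); linarith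
  · have := h 13 (by simp) (by rw [s17]; norm_num [Real.dist_eq]); linarith
  · have := h 25 (by simp) (by rw [s21]; norm_num [Real.dist_eq]); linarith
  · simp
  · simp

theorem isLocalMaxPt_lineX_seven : IsLocalMaxPt lineX 2 7 := by
  obtain ⟨s7, s8, s10, s13, s17, s21, s25, s27⟩ := sparsity_lineX
  refine ⟨by simp, fun y hy _ => ?_⟩
  simp only [Finset.mem_insert, Finset.mem_singleton] at hy
  rcases hy with rfl | rfl | rfl | rfl | rfl | rfl | rfl | rfl <;> linarith

theorem Aell_lineX_le_one :
    Aell lineX 2 {({7, 8, 10, 13, 21} : Finset ℝ), ({17, 25, 27} : Finset ℝ)} ≤ 1 := by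
  obtain ⟨s7, s8, s10, s13, s17, s21, s25, s27⟩ := sparsity_lineX
  refine csInf_le ⟨relSep lineX 2 7 7, fun A hA => hA 7 (by simp) isLocalMaxPt_lineX_seven
    {7, 8, 10, 13, 21} (by simp) (by simp) 7 (by simp) le_rfl⟩ ?_
  intro x hx hmax c hc hxc y hyc hyx
  have hyX : y ∈ lineX := by
    simp only [Finset.mem_insert, Finset.mem_singleton] at hc ⊢
    rcases hc with rfl | rfl <;> simp only [Finset.mem_insert, Finset.mem_singleton] at hyc <;>
      tauto
  refine div_le_one_of_le₀ (epsDist_le_of_epsConn (.of_dist_le hx hyX le_rfl hyx ?_))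
    (sparsity_nonneg _ _ _)
  simp only [Finset.mem_insert, Finset.mem_singleton] at hc
  rcases hc with rfl | rfl <;> simp only [Finset.mem_insert, Finset.mem_singleton] at hyc <;>
    rcases isLocalMaxPt_lineX hmax with rfl | rfl | rfl | rfl <;> norm_num at hxc <;>
    rcases hyc with rfl | rfl | rfl | rfl | rfl <;>
    first
      | (exfalso; linarith)
      | (simp only [s7, s8, s25, s27]; norm_num [Real.dist_eq])

theorem one_lt_relSepCluster_left {z : ℝ}
    (hz : z ∈ minSparsityPts lineX 2 ({7, 8, 10, 13, 21} : Finset ℝ)) :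
    1 < relSepCluster lineX 2 z {17, 25, 27} := by
  obtain ⟨s7, s8, s10, s13, s17, s21, s25, s27⟩ := sparsity_lineX
  obtain ⟨hz, hmin⟩ := Finset.mem_filter.1 hz
  have hzs := hmin 7 (by simp)
  have hz' : z ∈ lineX ∧ sparsity lineX 2 z = 1 := by
    simp only [Finset.mem_insert, Finset.mem_singleton] at hz
    rcases hz with rfl | rfl | rfl | rfl | rfl <;>
      first
        | (exfalso; linarith)
        | exact ⟨by simp, by assumption⟩
  refine one_lt_two.trans_le (relSepCluster_ge (by simp) fun y hy => ?_)
  rw [relSep, hz'.2, div_one]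
  have hy' : y ∈ lineX ∧ 2 ≤ sparsity lineX 2 y := by
    simp only [Finset.mem_insert, Finset.mem_singleton] at hy
    rcases hy with rfl | rfl | rfl <;> exact ⟨by simp, by linarith⟩
  exact le_epsDist hz'.1 hy'.1 fun ε h => hy'.2.trans h.sparsity_right_le

theorem one_lt_relSepCluster_right {z : ℝ}
    (hz : z ∈ minSparsityPts lineX 2 ({17, 25, 27} : Finset ℝ)) :
    1 < relSepCluster lineX 2 z {7, 8, 10, 13, 21} := by
  obtain ⟨s7, s8, s10, s13, s17, s21, s25, s27⟩ := sparsity_lineX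
  obtain ⟨hz, hmin⟩ := Finset.mem_filter.1 hz
  have hzs := hmin 25 (by simp)
  have hz' : z ∈ lineX ∧ sparsity lineX 2 z = 2 ∧ 25 ≤ z := by
    simp only [Finset.mem_insert, Finset.mem_singleton] at hz
    rcases hz with rfl | rfl | rfl <;>
      first
        | (exfalso; linarith)
        | exact ⟨by simp, by assumption, by norm_num⟩
  refine lt_of_lt_of_le (b := 3 / 2) (by norm_num)
    (relSepCluster_ge (by simp) fun y hy => ?_)
  rw [relSep, hz'.2.1]
  have hy' : y ∈ lineX ∧ y < 25 := by
    simp only [Finset.mem_insert, Finset.mem_singleton] at hy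
    rcases hy with rfl | rfl | rfl | rfl | rfl <;> exact ⟨by simp, by norm_num⟩
  have h3 : 3 ≤ epsDist lineX 2 z y := by
    refine le_epsDist hz'.1 hy'.1 fun ε h => ?_
    by_contra! hε
    refine hy'.2.not_ge (h.mem_of_closed (s := Set.Ici 25) (fun a ha b hb hab => ?_) hz'.2.2)
    have hab' := (le_abs_self (a - b)).trans hab
    simp only [Set.mem_Ici] at ha ⊢
    simp only [Finset.mem_insert, Finset.mem_singleton] at hb
    rcases hb with rfl | rfl | rfl | rfl | rfl | rfl | rfl | rfl <;> linarith
  linarith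

/-- the 2-clustering {{7,8,10,13,21},{17,25,27}} of
X = {7,8,10,13,17,21,25,27} ⊂ ℝ is LM-separable but not weakly separable for N_p = 2. -/
theorem stmt_12 :
    LMSeparable ({7, 8, 10, 13, 17, 21, 25, 27} : Finset ℝ) 2
      ({({7, 8, 10, 13, 21} : Finset ℝ), ({17, 25, 27} : Finset ℝ)} : Finset (Finset ℝ)) ∧
    ¬ WeaklySeparable ({7, 8, 10, 13, 17, 21, 25, 27} : Finset ℝ) 2
      ({({7, 8, 10, 13, 21} : Finset ℝ), ({17, 25, 27} : Finset ℝ)} : Finset (Finset ℝ)) := by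
  constructor
  · intro c hc c' hc' hne z hz
    refine Aell_lineX_le_one.trans_lt ?_
    rw [Finset.mem_insert, Finset.mem_singleton] at hc hc'
    rcases hc with rfl | rfl <;> rcases hc' with rfl | rfl
    · exact absurd rfl hne
    · exact one_lt_relSepCluster_left hz
    · exact one_lt_relSepCluster_right hz
    · exact absurd rfl hne
  · intro h
    obtain ⟨s7, s8, s10, s13, s17, s21, s25, s27⟩ := sparsity_lineX
    have hne : ({7, 8, 10, 13, 21} : Finset ℝ) ≠ {17, 25, 27} := by
      intro he
      have h7 : (7 : ℝ) ∈ ({17, 25, 27} : Finset ℝ) := he ▸ by simp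
      norm_num at h7
    have hlt := h {17, 25, 27} (by simp) {7, 8, 10, 13, 21} (by simp) hne
    have hle : clusterDist lineX 2 {17, 25, 27} {7, 8, 10, 13, 21} ≤ 4 :=
      (clusterDist_le lineX 2 (x := 17) (y := 21) (by simp) (by simp)).trans
        (epsDist_le_of_epsConn (.of_dist_le (by simp) (by simp) s17.le s21.le
          (by norm_num [Real.dist_eq])))
    have hge : 4 ≤ setSparsity lineX 2 {17, 25, 27} := by
      refine le_csInf ⟨10, fun x hx y hy => ?_⟩ fun ε hε =>
        s17.ge.trans (hε 17 (by simp) 17 (by simp)).2.1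
      simp only [Finset.mem_insert, Finset.mem_singleton] at hx hy
      rcases hx with rfl | rfl | rfl <;> rcases hy with rfl | rfl | rfl <;>
        exact .of_dist_le (by simp) (by simp) (by linarith) (by linarith)
          (by norm_num [Real.dist_eq])
    linarith
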